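/- Consider binary classification with a finite hypothesis class H and the zero-one loss. Then for any prior probability measure P on H and any δ ∈ (0,1), with probability at least 1−δ over S ∼ D^m, simultaneously for all probability measures Q on H: Δ_S(Q) ≤ √( 2·L̂_S(Q)·( ln(4|H|/δ)·D_TV(Q,P) + ln(4√m/δ) )/m ) + 2·( ln(4|H|/δ)·D_TV(Q,P) + ln(4√m/δ) )/m. -/

import Mathlib

open MeasureTheory Real

/-- The expected risk `L_D(h) = E_{z∼D} ℓ(h,z)`. -/
noncomputable def expRisk {H Z : Type*} [MeasurableSpace Z]
    (D : Measure Z) (ℓ : H → Z → ℝ) (h : H) : ℝ := ∫ z, ℓ h z ∂D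

/-- The empirical risk `L̂_S(h) = (1/m) ∑ᵢ ℓ(h,zᵢ)`. -/
noncomputable def empRisk {H Z : Type*} {m : ℕ}
    (ℓ : H → Z → ℝ) (S : Fin m → Z) (h : H) : ℝ :=
  (1 / (m : ℝ)) * ∑ i, ℓ h (S i)

/-- The generalization gap `Δ_S(h) = L_D(h) − L̂_S(h)`. -/
noncomputable def gap {H Z : Type*} [MeasurableSpace Z] {m : ℕ}
    (D : Measure Z) (ℓ : H → Z → ℝ) (S : Fin m → Z) (h : H) : ℝ :=
  expRisk D ℓ h - empRisk ℓ S h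

/-- The generalization gap of a posterior `Δ_S(Q) = E_{h∼Q} Δ_S(h)`. -/
noncomputable def gapQ {H Z : Type*} [MeasurableSpace Z] [MeasurableSpace H] {m : ℕ}
    (D : Measure Z) (ℓ : H → Z → ℝ) (S : Fin m → Z) (Q : Measure H) : ℝ :=
  ∫ h, gap D ℓ S h ∂Q

/-- The total variation distance `D_TV(Q,P) = sup_{A measurable} |P(A) − Q(A)|`. -/
noncomputable def tvDist {H : Type*} [MeasurableSpace H] (Q P : Measure H) : ℝ :=
  sSup {x | ∃ A : Set H, MeasurableSet A ∧ x = |(P A).toReal - (Q A).toReal|}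

lemma exp_neg_le_quadratic {x : ℝ} (hx : 0 ≤ x) : exp (-x) ≤ 1 - x + x ^ 2 / 2 := by
  have h := quadratic_le_exp_of_nonneg hx
  rw [exp_neg, inv_le_comm₀ (exp_pos x) (by nlinarith [sq_nonneg (x - 1)])]
  refine le_trans ?_ h
  rw [inv_le_iff_one_le_mul₀ (by nlinarith [sq_nonneg (x - 1)])]
  nlinarith [sq_nonneg (x ^ 2)]

lemma integrable_of_measurable_of_finite {α : Type*} [Finite α] [MeasurableSpace α]
    {μ : Measure α} [IsFiniteMeasure μ] {f : α → ℝ} (hf : Measurable f) : Integrable f μ :=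
  ⟨hf.aestronglyMeasurable, .of_finite⟩

section ZeroOne

variable {Z : Type*} [MeasurableSpace Z] {D : Measure Z} [IsProbabilityMeasure D] {f : Z → ℝ}

lemma integrable_of_zero_one (hf : Measurable f) (h01 : ∀ z, f z = 0 ∨ f z = 1) :
    Integrable f D :=
  Integrable.of_mem_Icc 0 1 hf.aemeasurable <| .of_forall fun z => by
    rcases h01 z with h | h <;> simp [h]

lemma integral_mem_Icc_of_zero_one (hf : Measurable f) (h01 : ∀ z, f z = 0 ∨ f z = 1) :
    ∫ z, f z ∂D ∈ Set.Icc (0 : ℝ) 1 := by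
  constructor
  · exact integral_nonneg fun z => by rcases h01 z with h | h <;> simp [h]
  · calc ∫ z, f z ∂D ≤ ∫ _, (1 : ℝ) ∂D :=
          integral_mono (integrable_of_zero_one hf h01) (integrable_const _)
            fun z => by rcases h01 z with h | h <;> simp [h]
      _ = 1 := by simp

lemma integral_exp_mul_integral_sub_le (hf : Measurable f) (h01 : ∀ z, f z = 0 ∨ f z = 1)
    {θ : ℝ} (hθ : 0 ≤ θ) :
    ∫ z, exp (θ * (∫ y, f y ∂D - f z)) ∂D ≤ exp ((∫ y, f y ∂D) * θ ^ 2 / 2) := by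
  set p := ∫ y, f y ∂D with hp
  have hp0 : 0 ≤ p := (integral_mem_Icc_of_zero_one hf h01).1
  have hpt : ∀ z, exp (θ * (p - f z)) = exp (θ * p) * (1 + f z * (exp (-θ) - 1)) := by
    intro z
    rcases h01 z with h | h
    · simp [h]
    · rw [h, one_mul, add_sub_cancel, ← exp_add]
      ring_nf
  have hfi := integrable_of_zero_one (D := D) hf h01
  simp_rw [hpt]
  rw [integral_const_mul, integral_add (integrable_const _) (hfi.mul_const _),
    integral_mul_const, ← hp]
  have hle : 1 + p * (exp (-θ) - 1) ≤ exp (p * (exp (-θ) - 1)) := by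
    linarith [add_one_le_exp (p * (exp (-θ) - 1))]
  calc exp (θ * p) * (∫ _, (1 : ℝ) ∂D + p * (exp (-θ) - 1))
      ≤ exp (θ * p) * exp (p * (exp (-θ) - 1)) := by
        simpa using mul_le_mul_of_nonneg_left hle (exp_pos (θ * p)).le
    _ = exp (θ * p + p * (exp (-θ) - 1)) := (exp_add _ _).symm
    _ ≤ exp (p * θ ^ 2 / 2) := by
        gcongr
        nlinarith [exp_neg_le_quadratic hθ]

/-- One-sided exponential moment bound for the empirical mean of zero-one variables. -/
lemma lintegral_exp_mul_sum_integral_sub_le (hf : Measurable f)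
    (h01 : ∀ z, f z = 0 ∨ f z = 1) (m : ℕ) {θ : ℝ} (hθ : 0 ≤ θ) :
    ∫⁻ S, ENNReal.ofReal (exp (θ * ∑ i, (∫ y, f y ∂D - f (S i))))
        ∂(Measure.pi fun _ : Fin m => D)
      ≤ ENNReal.ofReal (exp (m * (∫ y, f y ∂D) * θ ^ 2 / 2)) := by
  set p := ∫ y, f y ∂D with hp
  have hprod : ∀ S : Fin m → Z,
      exp (θ * ∑ i, (p - f (S i))) = ∏ i, exp (θ * (p - f (S i))) := by
    intro S
    rw [Finset.mul_sum, exp_sum]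
  have hint : Integrable (fun z => exp (θ * (p - f z))) D := by
    refine Integrable.of_mem_Icc 0 (exp (θ * p))
      ((hf.const_sub p).const_mul θ).exp.aemeasurable (.of_forall fun z => ?_)
    refine ⟨(exp_pos _).le, ?_⟩
    rcases h01 z with h | h <;> rw [h] <;> gcongr <;> linarith
  have hintS : Integrable (fun S : Fin m → Z => exp (θ * ∑ i, (p - f (S i))))
      (Measure.pi fun _ : Fin m => D) := by
    simp_rw [hprod]
    exact Integrable.fintype_prod fun _ => hint
  rw [← ofReal_integral_eq_lintegral_ofReal hintS (.of_forall fun S => (exp_pos _).le)]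
  refine ENNReal.ofReal_le_ofReal ?_
  simp_rw [hprod]
  rw [integral_fintype_prod_eq_pow (fun z => exp (θ * (p - f z))), Fintype.card_fin]
  calc (∫ z, exp (θ * (p - f z)) ∂D) ^ m ≤ (exp (p * θ ^ 2 / 2)) ^ m :=
        pow_le_pow_left₀ (integral_nonneg fun z => (exp_pos (θ * (p - f z))).le)
          (integral_exp_mul_integral_sub_le hf h01 hθ) m
    _ = exp (m * p * θ ^ 2 / 2) := by
        rw [← exp_nat_mul]
        ring_nf

end ZeroOne

/-- The normalized squared lower deviation `m (p - q)₊² / (2 p)` of an empirical mean `q`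
from its expectation `p`. -/
noncomputable def lowerDev (m : ℕ) (p q : ℝ) : ℝ := m * max (p - q) 0 ^ 2 / (2 * p)

lemma lowerDev_nonneg {m : ℕ} {p q : ℝ} (hp : 0 ≤ p) : 0 ≤ lowerDev m p q := by
  unfold lowerDev
  positivity

lemma lowerDev_eq_zero {m : ℕ} {p q : ℝ} (h : p ≤ q) : lowerDev m p q = 0 := by
  simp [lowerDev, max_eq_right (sub_nonpos.2 h)]

lemma lowerDev_of_le {m : ℕ} {p q : ℝ} (h : q ≤ p) :
    lowerDev m p q = m * (p - q) ^ 2 / (2 * p) := by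
  simp [lowerDev, max_eq_left (sub_nonneg.2 h)]

/-- The linearized form of the relation between the deviation and `lowerDev`. -/
lemma sub_le_mul_add_lowerDev {m : ℕ} (hm : 0 < m) {p q a : ℝ} (hp : 0 ≤ p) (hq : 0 ≤ q)
    (ha : 0 < a) : p - q ≤ a / 2 * p + (1 / (a * m)) * lowerDev m p q := by
  rcases le_or_gt p q with h | h
  · rw [lowerDev_eq_zero h]
    have : 0 ≤ a / 2 * p := by positivity
    linarith
  · have hp' : 0 < p := hq.trans_lt h
    have hm' : (0 : ℝ) < m := by exact_mod_cast hm
    rw [lowerDev_of_le h.le]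
    have : a / 2 * p + (1 / (a * m)) * (m * (p - q) ^ 2 / (2 * p)) - (p - q)
        = (a * p - (p - q)) ^ 2 / (2 * a * p) := by
      field_simp
      ring
    have h2 : 0 ≤ (a * p - (p - q)) ^ 2 / (2 * a * p) := by positivity
    linarith

/-- The exponential of `lowerDev` is dominated by finitely many exponential tilts with
parameters on a grid in `[0, 1]`. -/
lemma exp_lowerDev_le_sum {m : ℕ} (hm : 0 < m) {p q : ℝ} (hp1 : p ≤ 1) (hq : 0 ≤ q) :
    exp (lowerDev m p q) ≤ exp (3 / 8) * ∑ j ∈ Finset.range (m.sqrt + 1),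
      exp ((j / m.sqrt : ℝ) * (m * (p - q)) - m * p * (j / m.sqrt : ℝ) ^ 2 / 2) := by
  have hN : 0 < m.sqrt := Nat.sqrt_pos.2 hm
  set N := m.sqrt with hNdef
  have hN' : (0 : ℝ) < N := by exact_mod_cast hN
  have hmN : (m : ℝ) ≤ 3 * N ^ 2 := by
    have h1 : m ≤ N * N + N + N := Nat.sqrt_le_add m
    have h2 : N ≤ N * N := Nat.le_mul_self N
    have : m ≤ 3 * N ^ 2 := by nlinarith
    exact_mod_cast this
  suffices h : ∃ j ∈ Finset.range (N + 1), lowerDev m p q ≤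
      3 / 8 + ((j / N : ℝ) * (m * (p - q)) - m * p * (j / N : ℝ) ^ 2 / 2) by
    obtain ⟨j, hj, hle⟩ := h
    calc exp (lowerDev m p q)
        ≤ exp (3 / 8) * exp ((j / N : ℝ) * (m * (p - q)) - m * p * (j / N : ℝ) ^ 2 / 2) := by
          rw [← exp_add]
          gcongr
      _ ≤ _ := by
          gcongr
          exact Finset.single_le_sum
            (f := fun j : ℕ =>
              exp ((j / N : ℝ) * (m * (p - q)) - m * p * (j / N : ℝ) ^ 2 / 2))
            (fun i _ => (exp_pos _).le) hj
  rcases le_or_gt p q with h | h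
  · refine ⟨0, by simp, ?_⟩
    rw [lowerDev_eq_zero h]
    norm_num
  · have hp' : 0 < p := hq.trans_lt h
    set t := (p - q) / p with ht
    have ht0 : 0 ≤ t := div_nonneg (by linarith) hp'.le
    have ht1 : t ≤ 1 := (div_le_one hp').2 (by linarith)
    have hround := abs_le.1 (abs_sub_round (N * t))
    have hr0 : 0 ≤ round (N * t) := by
      have : (-1 : ℝ) < round (N * t) := by nlinarith [mul_nonneg hN'.le ht0]
      have : (-1 : ℤ) < round (N * t) := by exact_mod_cast this
      omega
    obtain ⟨j, hj⟩ := Int.eq_ofNat_of_zero_le hr0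
    have hjr : (round (N * t) : ℝ) = j := by rw [hj]; simp
    rw [hjr] at hround
    have hjN : j < N + 1 := by
      have : (j : ℝ) < N + 1 := by nlinarith
      exact_mod_cast this
    refine ⟨j, Finset.mem_range.2 hjN, ?_⟩
    have hpq : p - q = p * t := by rw [ht]; field_simp
    have hX : lowerDev m p q = m * p * t ^ 2 / 2 := by
      rw [lowerDev_of_le h.le, hpq]
      field_simp
    have hsq : (N * t - j) ^ 2 ≤ 1 / 4 := by nlinarith
    have hgap : m * p * (t - j / N) ^ 2 ≤ 3 / 4 := by
      have h1 : (t - j / N) ^ 2 = (N * t - j) ^ 2 / N ^ 2 := by field_simp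
      calc m * p * (t - j / N) ^ 2 ≤ (3 * N ^ 2) * 1 * ((1 / 4) / N ^ 2) := by
            rw [h1]
            gcongr
        _ = 3 / 4 := by field_simp
    rw [hX, hpq]
    nlinarith

lemma empiricalMean_nonneg {Z : Type*} {f : Z → ℝ} (h01 : ∀ z, f z = 0 ∨ f z = 1)
    {m : ℕ} (S : Fin m → Z) :
    0 ≤ (1 / (m : ℝ)) * ∑ i, f (S i) :=
  mul_nonneg (by positivity) <| Finset.sum_nonneg fun i _ => by
    rcases h01 (S i) with h | h <;> simp [h]

lemma mul_sub_empiricalMean {Z : Type*} {f : Z → ℝ} {m : ℕ} (hm : 0 < m) (p : ℝ)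
    (S : Fin m → Z) :
    m * (p - (1 / (m : ℝ)) * ∑ i, f (S i)) = ∑ i, (p - f (S i)) := by
  have hm' : (0 : ℝ) < m := by exact_mod_cast hm
  simp only [Finset.sum_sub_distrib, Finset.sum_const, Finset.card_univ, Fintype.card_fin,
    nsmul_eq_mul]
  field_simp

section ZeroOne

variable {Z : Type*} [MeasurableSpace Z] {D : Measure Z} [IsProbabilityMeasure D] {f : Z → ℝ}

lemma measurable_exp_mul_sum_sub (hf : Measurable f) (m : ℕ) (θ p : ℝ) :
    Measurable fun S : Fin m → Z => ENNReal.ofReal (exp (θ * ∑ i, (p - f (S i)))) := by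
  have hsum : Measurable fun S : Fin m → Z => ∑ i, (p - f (S i)) :=
    Finset.measurable_sum _ fun i _ => (hf.comp (measurable_pi_apply i)).const_sub p
  exact (hsum.const_mul θ).exp.ennreal_ofReal

lemma lintegral_exp_lowerDev_le (hf : Measurable f) (h01 : ∀ z, f z = 0 ∨ f z = 1)
    {m : ℕ} (hm : 0 < m) :
    ∫⁻ S, ENNReal.ofReal (exp (lowerDev m (∫ z, f z ∂D) ((1 / (m : ℝ)) * ∑ i, f (S i))))
        ∂(Measure.pi fun _ : Fin m => D) ≤ ENNReal.ofReal (3 * √m) := by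
  set p := ∫ z, f z ∂D with hp
  obtain ⟨-, hp1⟩ := integral_mem_Icc_of_zero_one (D := D) hf h01
  have hpt : ∀ S : Fin m → Z,
      ENNReal.ofReal (exp (lowerDev m p ((1 / (m : ℝ)) * ∑ i, f (S i)))) ≤
      ENNReal.ofReal (exp (3 / 8)) * ∑ j ∈ Finset.range (m.sqrt + 1),
        ENNReal.ofReal (exp (-(m * p * (j / m.sqrt : ℝ) ^ 2 / 2))) *
          ENNReal.ofReal (exp ((j / m.sqrt : ℝ) * ∑ i, (p - f (S i)))) := by
    intro S
    refine (ENNReal.ofReal_le_ofReal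
      (exp_lowerDev_le_sum hm hp1 (empiricalMean_nonneg h01 S))).trans_eq ?_
    rw [ENNReal.ofReal_mul (exp_pos _).le,
      ENNReal.ofReal_sum_of_nonneg fun _ _ => (exp_pos _).le]
    congr 1
    refine Finset.sum_congr rfl fun j _ => ?_
    rw [← ENNReal.ofReal_mul (exp_pos _).le, ← exp_add, mul_sub_empiricalMean hm]
    congr 2
    ring
  have hN : (m.sqrt : ℝ) ≤ √m := Real.nat_sqrt_le_real_sqrt
  have h1 : 1 ≤ √(m : ℝ) := Real.one_le_sqrt.2 (by exact_mod_cast hm)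
  have hexp : exp (3 / 8 : ℝ) ≤ 3 / 2 := by
    have h8 : exp (3 / 8 : ℝ) ^ 8 ≤ (3 / 2) ^ 8 := by
      rw [← exp_nat_mul]
      have : exp (((8 : ℕ) : ℝ) * (3 / 8)) = exp 1 ^ 3 := by
        rw [← exp_nat_mul]
        norm_num
      rw [this]
      calc exp 1 ^ 3 ≤ (2.7182818286 : ℝ) ^ 3 := by
            gcongr
            exact exp_one_lt_d9.le
        _ ≤ _ := by norm_num
    exact le_of_pow_le_pow_left₀ (by norm_num) (by norm_num) h8
  calc _ ≤ ∫⁻ S, ENNReal.ofReal (exp (3 / 8)) * ∑ j ∈ Finset.range (m.sqrt + 1),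
        ENNReal.ofReal (exp (-(m * p * (j / m.sqrt : ℝ) ^ 2 / 2))) *
          ENNReal.ofReal (exp ((j / m.sqrt : ℝ) * ∑ i, (p - f (S i))))
        ∂(Measure.pi fun _ : Fin m => D) := lintegral_mono hpt
    _ = ENNReal.ofReal (exp (3 / 8)) * ∑ j ∈ Finset.range (m.sqrt + 1),
        ENNReal.ofReal (exp (-(m * p * (j / m.sqrt : ℝ) ^ 2 / 2))) *
          ∫⁻ S, ENNReal.ofReal (exp ((j / m.sqrt : ℝ) * ∑ i, (p - f (S i))))
            ∂(Measure.pi fun _ : Fin m => D) := by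
        have hmeas := fun j : ℕ => measurable_exp_mul_sum_sub hf m (j / m.sqrt : ℝ) p
        rw [lintegral_const_mul _ (Finset.measurable_sum _ fun j _ => (hmeas j).const_mul _),
          lintegral_finsetSum _ fun j _ => (hmeas j).const_mul _]
        congr 1
        refine Finset.sum_congr rfl fun j _ => ?_
        rw [lintegral_const_mul _ (hmeas j)]
    _ ≤ ENNReal.ofReal (exp (3 / 8)) * ∑ j ∈ Finset.range (m.sqrt + 1), 1 := by
        gcongr with j
        refine (mul_le_mul_right
          (lintegral_exp_mul_sum_integral_sub_le hf h01 m (by positivity)) _).trans_eq ?_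
        rw [← hp, ← ENNReal.ofReal_mul (exp_pos _).le, ← exp_add]
        simp
    _ = ENNReal.ofReal (exp (3 / 8) * (m.sqrt + 1)) := by
        rw [ENNReal.ofReal_mul (exp_pos _).le, Finset.sum_const, Finset.card_range,
          nsmul_one, ← Nat.cast_succ, ENNReal.ofReal_natCast]
    _ ≤ ENNReal.ofReal (3 * √m) := by
        refine ENNReal.ofReal_le_ofReal ?_
        calc exp (3 / 8) * (m.sqrt + 1) ≤ 3 / 2 * (√m + √m) := by gcongr
          _ = 3 * √m := by ring

lemma measure_le_lowerDev_le (hf : Measurable f) (h01 : ∀ z, f z = 0 ∨ f z = 1)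
    {m : ℕ} (hm : 0 < m) {s : ℝ} (hs : 0 < s) :
    (Measure.pi fun _ : Fin m => D)
      {S | s ≤ lowerDev m (∫ z, f z ∂D) ((1 / (m : ℝ)) * ∑ i, f (S i))}
      ≤ ENNReal.ofReal (exp (-s)) := by
  set p := ∫ z, f z ∂D with hp
  have hm' : (0 : ℝ) < m := by exact_mod_cast hm
  obtain ⟨hp0, -⟩ := integral_mem_Icc_of_zero_one (D := D) hf h01
  rw [← hp] at hp0
  set θ := √(2 * s / (m * p)) with hθ
  have hθ0 : 0 ≤ θ := Real.sqrt_nonneg _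
  have hsub : {S : Fin m → Z | s ≤ lowerDev m p ((1 / (m : ℝ)) * ∑ i, f (S i))} ⊆
      {S | ENNReal.ofReal (exp (m * p * θ ^ 2)) ≤
        ENNReal.ofReal (exp (θ * ∑ i, (p - f (S i))))} := by
    intro S hS
    simp only [Set.mem_ofPred_eq] at hS ⊢
    rw [← mul_sub_empiricalMean hm]
    have hq := empiricalMean_nonneg h01 S
    set q := (1 / (m : ℝ)) * ∑ i, f (S i)
    refine ENNReal.ofReal_le_ofReal (exp_le_exp.2 ?_)
    have hlt : q < p := by
      by_contra! h
      rw [lowerDev_eq_zero h] at hS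
      linarith
    have hp' : 0 < p := hq.trans_lt hlt
    rw [lowerDev_of_le hlt.le, le_div_iff₀ (by positivity)] at hS
    have hle : θ ≤ (p - q) / p := by
      refine Real.sqrt_le_iff.2 ⟨div_nonneg (by linarith) hp'.le, ?_⟩
      rw [div_pow, div_le_div_iff₀ (by positivity) (by positivity)]
      nlinarith
    rw [le_div_iff₀ hp'] at hle
    have := mul_le_mul_of_nonneg_left hle (mul_nonneg hm'.le hθ0)
    nlinarith
  rcases hp0.eq_or_lt with hp0 | hp0
  · have : {S : Fin m → Z | s ≤ lowerDev m p ((1 / (m : ℝ)) * ∑ i, f (S i))} = ∅ := by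
      ext S
      simp [lowerDev, ← hp0, hs]
    rw [this, measure_empty]
    exact zero_le
  have hθsq : m * p * θ ^ 2 = 2 * s := by
    rw [hθ, Real.sq_sqrt (by positivity)]
    field_simp
  refine (measure_mono hsub).trans ((meas_ge_le_lintegral_div
    (measurable_exp_mul_sum_sub hf m θ p).aemeasurable
    (by simp [exp_pos]) ENNReal.ofReal_ne_top).trans ?_)
  refine (ENNReal.div_le_div_right
    (lintegral_exp_mul_sum_integral_sub_le hf h01 m hθ0) _).trans_eq ?_
  rw [← hp, ← ENNReal.ofReal_div_of_pos (exp_pos _), ← exp_sub, hθsq]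
  ring_nf

end ZeroOne

lemma abs_measureReal_sub_le_tvDist {H : Type*} [MeasurableSpace H] (Q P : Measure H)
    [IsProbabilityMeasure Q] [IsProbabilityMeasure P] {A : Set H} (hA : MeasurableSet A) :
    |P.real A - Q.real A| ≤ tvDist Q P := by
  refine le_csSup ⟨1, ?_⟩ ⟨A, hA, rfl⟩
  rintro x ⟨B, -, rfl⟩
  have h1 : P.real B ≤ 1 := measureReal_le_one
  have h2 : Q.real B ≤ 1 := measureReal_le_one
  have h3 : 0 ≤ P.real B := measureReal_nonneg
  have h4 : 0 ≤ Q.real B := measureReal_nonneg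
  change |P.real B - Q.real B| ≤ 1
  rw [abs_le]
  constructor <;> linarith

lemma tvDist_nonneg {H : Type*} [MeasurableSpace H] (Q P : Measure H) : 0 ≤ tvDist Q P := by
  refine Real.sSup_nonneg ?_
  rintro x ⟨B, -, rfl⟩
  exact abs_nonneg _

/-- Change of measure in total variation for functions with values in `[0, M]`. -/
lemma integral_le_add_mul_tvDist {H : Type*} [MeasurableSpace H] (Q P : Measure H)
    [IsProbabilityMeasure Q] [IsProbabilityMeasure P] {f : H → ℝ} (hf : Measurable f)
    {M : ℝ} (hM : 0 ≤ M) (h0 : ∀ h, 0 ≤ f h) (hfM : ∀ h, f h ≤ M) :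
    ∫ h, f h ∂Q ≤ ∫ h, f h ∂P + M * tvDist Q P := by
  have hint : ∀ R : Measure H, IsProbabilityMeasure R → Integrable f R := fun R _ =>
    Integrable.of_mem_Icc 0 M hf.aemeasurable (.of_forall fun h => ⟨h0 h, hfM h⟩)
  have htail : ∀ R : Measure H, IsProbabilityMeasure R →
      IntervalIntegrable (fun t => R.real {a | t ≤ f a}) volume 0 M := fun R _ =>
    Antitone.intervalIntegrable fun s t hst => measureReal_mono fun a ha => hst.trans ha
  rw [(hint Q inferInstance).integral_eq_integral_Ioc_meas_le (.of_forall h0) (.of_forall hfM),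
    (hint P inferInstance).integral_eq_integral_Ioc_meas_le (.of_forall h0) (.of_forall hfM),
    ← intervalIntegral.integral_of_le hM, ← intervalIntegral.integral_of_le hM]
  calc ∫ t in (0 : ℝ)..M, Q.real {a | t ≤ f a}
      ≤ ∫ t in (0 : ℝ)..M, (P.real {a | t ≤ f a} + tvDist Q P) := by
        refine intervalIntegral.integral_mono_on hM (htail Q inferInstance)
          ((htail P inferInstance).add intervalIntegrable_const) fun t _ => ?_
        have := (abs_le.1 (abs_measureReal_sub_le_tvDist Q P
          (measurableSet_le measurable_const hf : MeasurableSet {a | t ≤ f a}))).1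
        linarith
    _ = _ := by
        rw [intervalIntegral.integral_add (htail P inferInstance) intervalIntegrable_const]
        simp

/-- Solving the family of linear inequalities for the deviation. -/
lemma le_sqrt_add_of_forall_le {Δ q B : ℝ} (hq : 0 ≤ q) (hB : 0 ≤ B)
    (h : ∀ a, 0 < a → Δ ≤ a / 2 * (q + Δ) + B / a) : Δ ≤ √(2 * q * B) + 2 * B := by
  by_contra! hlt
  have hr := Real.sqrt_nonneg (2 * q * B)
  have hr2 := Real.sq_sqrt (show 0 ≤ 2 * q * B by positivity)
  set r := √(2 * q * B)
  have hΔ : 0 < Δ := by linarith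
  have hsum : 0 < q + Δ := by linarith
  have key := h (Δ / (q + Δ)) (by positivity)
  have e1 : Δ / (q + Δ) / 2 * (q + Δ) = Δ / 2 := by field_simp
  have e2 : B / (Δ / (q + Δ)) = B * (q + Δ) / Δ := by field_simp
  rw [e1, e2] at key
  have key2 : Δ / 2 ≤ B * (q + Δ) / Δ := by linarith
  rw [le_div_iff₀ hΔ] at key2
  nlinarith

/-- The deterministic part of the argument: a uniform bound and an exponential moment bound
on `lowerDev` control the generalization gap of every posterior. -/
lemma gapQ_le_of_lowerDev_le {Hyp Z : Type*} [Finite Hyp] [MeasurableSpace Hyp]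
    [MeasurableSpace Z] {D : Measure Z} {ℓ : Hyp → Z → ℝ} {m : ℕ} (hm : 0 < m)
    {S : Fin m → Z} {P : Measure Hyp} [IsProbabilityMeasure P]
    (hexp : Measurable (expRisk D ℓ)) (hempS : Measurable (empRisk ℓ S))
    (hp0 : ∀ h, 0 ≤ expRisk D ℓ h) (hq0 : ∀ h, 0 ≤ empRisk ℓ S h)
    {M c : ℝ} (hM : 0 ≤ M) (hc0 : 0 < c) (hlogc : 0 ≤ Real.log c)
    (hlt : ∀ h, lowerDev m (expRisk D ℓ h) (empRisk ℓ S h) ≤ M)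
    (hmoment : ∫⁻ h, ENNReal.ofReal (exp (lowerDev m (expRisk D ℓ h) (empRisk ℓ S h))) ∂P
      < ENNReal.ofReal c)
    (Q : Measure Hyp) [IsProbabilityMeasure Q] :
    gapQ D ℓ S Q ≤
      √(2 * (∫ h, empRisk ℓ S h ∂Q) * ((M * tvDist Q P + Real.log c) / m))
        + 2 * ((M * tvDist Q P + Real.log c) / m) := by
  have hm' : (0 : ℝ) < m := by exact_mod_cast hm
  set X : Hyp → ℝ := fun h => lowerDev m (expRisk D ℓ h) (empRisk ℓ S h) with hXdef
  have hX0 : ∀ h, 0 ≤ X h := fun h => lowerDev_nonneg (hp0 h)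
  have hX : Measurable X :=
    (((hexp.sub hempS).max measurable_const).pow_const 2 |>.const_mul _).div
      (hexp.const_mul 2)
  have hint : ∀ {R : Measure Hyp} [IsProbabilityMeasure R], Integrable X R :=
    integrable_of_measurable_of_finite hX
  have hPexp : ∫ h, exp (X h) ∂P ≤ c := by
    rw [← ofReal_integral_eq_lintegral_ofReal
      (integrable_of_measurable_of_finite hX.exp)
      (.of_forall fun h => (exp_pos _).le)] at hmoment
    exact ((ENNReal.ofReal_lt_ofReal_iff hc0).1 hmoment).le
  have hPX : ∫ h, X h ∂P ≤ Real.log c := by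
    calc ∫ h, X h ∂P ≤ ∫ h, (exp (X h) / c + (Real.log c - 1)) ∂P := by
          refine integral_mono hint (integrable_of_measurable_of_finite
            ((hX.exp.div_const c).add_const _)) fun h => ?_
          have := add_one_le_exp (X h - Real.log c)
          rw [exp_sub, exp_log hc0] at this
          change X h ≤ exp (X h) / c + (Real.log c - 1)
          linarith
      _ = (∫ h, exp (X h) ∂P) / c + (Real.log c - 1) := by
          rw [integral_add (integrable_of_measurable_of_finite (hX.exp.div_const c))
            (integrable_const _), integral_div]
          simp
      _ ≤ 1 + (Real.log c - 1) := by
          gcongr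
          exact (div_le_one hc0).2 hPexp
      _ = Real.log c := by ring
  have hQX : ∫ h, X h ∂Q ≤ M * tvDist Q P + Real.log c := by
    have := integral_le_add_mul_tvDist Q P hX hM hX0 fun h => hlt h
    linarith
  have hpi : Integrable (expRisk D ℓ) Q := integrable_of_measurable_of_finite hexp
  have hqi : Integrable (empRisk ℓ S) Q := integrable_of_measurable_of_finite hempS
  have hgap : gapQ D ℓ S Q = ∫ h, expRisk D ℓ h ∂Q - ∫ h, empRisk ℓ S h ∂Q :=
    integral_sub hpi hqi
  refine le_sqrt_add_of_forall_le (integral_nonneg hq0) ?_ fun a ha => ?_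
  · have := tvDist_nonneg Q P
    positivity
  · calc gapQ D ℓ S Q
        ≤ ∫ h, (a / 2 * expRisk D ℓ h + (1 / (a * m)) * X h) ∂Q :=
          integral_mono (hpi.sub hqi) ((hpi.const_mul _).add (hint.const_mul _))
            fun h => sub_le_mul_add_lowerDev hm (hp0 h) (hq0 h) ha
      _ = a / 2 * ∫ h, expRisk D ℓ h ∂Q + (1 / (a * m)) * ∫ h, X h ∂Q := by
          rw [integral_add (hpi.const_mul _) (hint.const_mul _), integral_const_mul,
            integral_const_mul]
      _ ≤ a / 2 * ∫ h, expRisk D ℓ h ∂Q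
            + (1 / (a * m)) * (M * tvDist Q P + Real.log c) := by gcongr
      _ = _ := by
          rw [hgap]
          field_simp
          ring

section HypothesisClass

variable {Hyp Z : Type*} [MeasurableSpace Z] {D : Measure Z} [IsProbabilityMeasure D]
  {ℓ : Hyp → Z → ℝ}

lemma measurable_expRisk [MeasurableSpace Hyp]
    (hmeas : Measurable (Function.uncurry ℓ)) :
    Measurable (expRisk D ℓ) :=
  (StronglyMeasurable.integral_prod_right' hmeas.stronglyMeasurable).measurable

lemma measurable_empRisk [MeasurableSpace Hyp]
    (hmeas : Measurable (Function.uncurry ℓ)) (m : ℕ) :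
    Measurable fun x : (Fin m → Z) × Hyp => empRisk ℓ x.1 x.2 := by
  have hsum : Measurable fun x : (Fin m → Z) × Hyp => ∑ i, ℓ x.2 (x.1 i) :=
    Finset.measurable_sum _ fun i _ =>
      hmeas.comp (measurable_snd.prodMk ((measurable_pi_apply i).comp measurable_fst))
  exact hsum.const_mul _

lemma measurable_lowerDev_risk [MeasurableSpace Hyp]
    (hmeas : Measurable (Function.uncurry ℓ)) (m : ℕ) :
    Measurable fun x : (Fin m → Z) × Hyp =>
      lowerDev m (expRisk D ℓ x.2) (empRisk ℓ x.1 x.2) := by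
  have hp : Measurable fun x : (Fin m → Z) × Hyp => expRisk D ℓ x.2 :=
    (measurable_expRisk hmeas).comp measurable_snd
  have hq := measurable_empRisk hmeas m
  exact (((hp.sub hq).max measurable_const).pow_const 2 |>.const_mul _).div (hp.const_mul 2)

/-- Union bound for `lowerDev` over a finite hypothesis class. -/
lemma measure_iUnion_le_lowerDev_le [Fintype Hyp]
    (hℓ : ∀ h, Measurable (ℓ h))
    (h01 : ∀ h z, ℓ h z = 0 ∨ ℓ h z = 1) {m : ℕ} (hm : 0 < m) {s : ℝ} (hs : 0 < s) :
    (Measure.pi fun _ : Fin m => D)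
      (⋃ h, {S | s ≤ lowerDev m (expRisk D ℓ h) (empRisk ℓ S h)})
      ≤ ENNReal.ofReal (Fintype.card Hyp * exp (-s)) := by
  refine (measure_iUnion_fintype_le _ _).trans ?_
  calc ∑ h, (Measure.pi fun _ : Fin m => D)
        {S | s ≤ lowerDev m (expRisk D ℓ h) (empRisk ℓ S h)}
      ≤ ∑ _h : Hyp, ENNReal.ofReal (exp (-s)) :=
        Finset.sum_le_sum fun h _ => measure_le_lowerDev_le (hℓ h) (h01 h) hm hs
    _ = ENNReal.ofReal (Fintype.card Hyp * exp (-s)) := by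
        rw [Finset.sum_const, Finset.card_univ, nsmul_eq_mul, ← ENNReal.ofReal_natCast,
          ← ENNReal.ofReal_mul (by positivity)]

/-- Markov's inequality for the prior average of the exponential moment of `lowerDev`. -/
lemma measure_le_lintegral_exp_lowerDev_le [MeasurableSpace Hyp]
    (hmeas : Measurable (Function.uncurry ℓ))
    (h01 : ∀ h z, ℓ h z = 0 ∨ ℓ h z = 1) {m : ℕ} (hm : 0 < m)
    (P : Measure Hyp) [IsProbabilityMeasure P] {c : ℝ} (hc : 0 < c) :
    (Measure.pi fun _ : Fin m => D)
      {S | ENNReal.ofReal c ≤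
        ∫⁻ h, ENNReal.ofReal (exp (lowerDev m (expRisk D ℓ h) (empRisk ℓ S h))) ∂P}
      ≤ ENNReal.ofReal (3 * √m / c) := by
  have hjoint : Measurable fun x : (Fin m → Z) × Hyp =>
      ENNReal.ofReal (exp (lowerDev m (expRisk D ℓ x.2) (empRisk ℓ x.1 x.2))) :=
    (measurable_lowerDev_risk hmeas m).exp.ennreal_ofReal
  have hmarg : Measurable fun S : Fin m → Z =>
      ∫⁻ h, ENNReal.ofReal (exp (lowerDev m (expRisk D ℓ h) (empRisk ℓ S h))) ∂P :=
    hjoint.lintegral_prod_right'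
  have hmoment : ∫⁻ S, ∫⁻ h,
      ENNReal.ofReal (exp (lowerDev m (expRisk D ℓ h) (empRisk ℓ S h))) ∂P
        ∂(Measure.pi fun _ : Fin m => D) ≤ ENNReal.ofReal (3 * √m) := by
    rw [lintegral_lintegral_swap hjoint.aemeasurable]
    calc ∫⁻ h, ∫⁻ S, ENNReal.ofReal (exp (lowerDev m (expRisk D ℓ h) (empRisk ℓ S h)))
          ∂(Measure.pi fun _ : Fin m => D) ∂P
        ≤ ∫⁻ _, ENNReal.ofReal (3 * √m) ∂P := lintegral_mono fun h =>
          lintegral_exp_lowerDev_le (hmeas.of_uncurry_left (x := h)) (h01 h) hm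
      _ = ENNReal.ofReal (3 * √m) := by simp
  refine (meas_ge_le_lintegral_div hmarg.aemeasurable
    (ENNReal.ofReal_pos.2 hc).ne' ENNReal.ofReal_ne_top).trans ?_
  rw [ENNReal.ofReal_div_of_pos hc]
  exact ENNReal.div_le_div_right hmoment _

end HypothesisClass

/-- Seeger-type total-variation PAC-Bayes bound for a finite hypothesis class with
zero-one loss (Appendix B of the paper). -/
theorem seeger_tv_pac_bayes_finite
    {Hyp Z : Type*} [Fintype Hyp] [MeasurableSpace Hyp] [MeasurableSpace Z]
    (D : Measure Z) [IsProbabilityMeasure D]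
    (ℓ : Hyp → Z → ℝ)
    (hmeas : Measurable (Function.uncurry ℓ))
    -- zero-one loss
    (h01 : ∀ (h : Hyp) (z : Z), ℓ h z = 0 ∨ ℓ h z = 1)
    (m : ℕ) (hm : 0 < m)
    (P : Measure Hyp) [IsProbabilityMeasure P]
    (δ : ℝ) (hδ : δ ∈ Set.Ioo (0 : ℝ) 1) :
    (Measure.pi fun _ : Fin m => D)
      {S | ∀ Q : Measure Hyp, IsProbabilityMeasure Q →
        gapQ D ℓ S Q ≤
          Real.sqrt (2 * (∫ h, empRisk ℓ S h ∂Q) *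
              ((Real.log (4 * Fintype.card Hyp / δ) * tvDist Q P
                + Real.log (4 * Real.sqrt m / δ)) / m))
            + 2 * ((Real.log (4 * Fintype.card Hyp / δ) * tvDist Q P
                + Real.log (4 * Real.sqrt m / δ)) / m)}
      ≥ ENNReal.ofReal (1 - δ) := by
  obtain ⟨hδ0, hδ1⟩ := hδ
  have hne : Nonempty Hyp := nonempty_of_isProbabilityMeasure P
  have hm' : (0 : ℝ) < m := by exact_mod_cast hm
  have hm1 : 1 ≤ √(m : ℝ) := Real.one_le_sqrt.2 (by exact_mod_cast hm)
  have hcard : (1 : ℝ) ≤ Fintype.card Hyp := by exact_mod_cast Fintype.card_pos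
  set n := (Fintype.card Hyp : ℝ) with hn
  set M := Real.log (4 * n / δ) with hMdef
  set c := 4 * √(m : ℝ) / δ with hcdef
  have hc0 : 0 < c := by positivity
  have hM : 0 < M := Real.log_pos (by rw [one_lt_div hδ0]; linarith)
  have hlogc : 0 < Real.log c := Real.log_pos (by rw [hcdef, one_lt_div hδ0]; linarith)
  have hℓ : ∀ h, Measurable (ℓ h) := fun h => hmeas.of_uncurry_left
  have hp0 : ∀ h, 0 ≤ expRisk D ℓ h := fun h =>
    (integral_mem_Icc_of_zero_one (hℓ h) (h01 h)).1
  have hq0 : ∀ (S : Fin m → Z) h, 0 ≤ empRisk ℓ S h := fun S h =>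
    empiricalMean_nonneg (h01 h) S
  set μ := Measure.pi fun _ : Fin m => D with hμ
  set good := {S : Fin m → Z | ∀ Q : Measure Hyp, IsProbabilityMeasure Q →
        gapQ D ℓ S Q ≤
          Real.sqrt (2 * (∫ h, empRisk ℓ S h ∂Q) * ((M * tvDist Q P + Real.log c) / m))
            + 2 * ((M * tvDist Q P + Real.log c) / m)} with hgood
  let bad₁ : Set (Fin m → Z) :=
    ⋃ h, {S | M ≤ lowerDev m (expRisk D ℓ h) (empRisk ℓ S h)}
  let bad₂ : Set (Fin m → Z) := {S | ENNReal.ofReal c ≤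
    ∫⁻ h, ENNReal.ofReal (exp (lowerDev m (expRisk D ℓ h) (empRisk ℓ S h))) ∂P}
  have hbad₁ : μ bad₁ ≤ ENNReal.ofReal (δ / 4) := by
    refine (measure_iUnion_le_lowerDev_le hℓ h01 hm hM).trans_eq ?_
    rw [exp_neg, exp_log (by positivity), ← hn]
    congr 1
    field_simp
  have hbad₂ : μ bad₂ ≤ ENNReal.ofReal (3 * δ / 4) := by
    refine (measure_le_lintegral_exp_lowerDev_le hmeas h01 hm P hc0).trans_eq ?_
    rw [hcdef]
    congr 1
    field_simp
  have hsub : goodᶜ ⊆ bad₁ ∪ bad₂ := by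
    intro S hS
    by_contra hnot
    simp only [bad₁, bad₂, Set.mem_union, Set.mem_iUnion, Set.mem_ofPred_eq, not_or, not_exists,
      not_le] at hnot
    obtain ⟨hlt, hmoment⟩ := hnot
    rw [Set.mem_compl_iff, hgood, Set.mem_ofPred_eq] at hS
    refine hS fun Q hQ => ?_
    exact gapQ_le_of_lowerDev_le hm (measurable_expRisk hmeas)
      ((measurable_empRisk hmeas m).comp measurable_prodMk_left) hp0 (hq0 S) hM.le hc0 hlogc.le
      (fun h => (hlt h).le) hmoment Q
  have hcompl : μ goodᶜ ≤ ENNReal.ofReal δ := by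
    calc μ goodᶜ ≤ μ bad₁ + μ bad₂ := (measure_mono hsub).trans (measure_union_le _ _)
      _ ≤ ENNReal.ofReal (δ / 4) + ENNReal.ofReal (3 * δ / 4) := add_le_add hbad₁ hbad₂
      _ = ENNReal.ofReal δ := by
          rw [← ENNReal.ofReal_add (by positivity) (by positivity)]
          ring_nf
  have htotal : 1 ≤ μ good + μ goodᶜ := by
    calc (1 : ENNReal) = μ (good ∪ goodᶜ) := by rw [Set.union_compl_self, measure_univ]
      _ ≤ _ := measure_union_le _ _
  rw [ge_iff_le, ENNReal.ofReal_sub _ hδ0.le, ENNReal.ofReal_one, tsub_le_iff_right]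
  exact htotal.trans (by gcongr)
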